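/- (Lemma 1, part (14)) Fix an illegal transition (i, j) ∈ Ω, a legal ground-truth path y, logits l, and a transition matrix A₀. For c ∈ ℝ, let gᶜ : ℝ → ℝ be the function sending t to the CRF likelihood L(l, B) where B agrees with Ā(A₀, c) at all entries except that B i j = t. Then the derivative of gᶜ at t = c tends to 0 as c → -∞ (i.e., it converges to the derivative of the masked-CRF likelihood with respect to the masked entry, which is 0 since L'(l, A) does not depend on entries of A indexed by Ω). -/

import Mathlib

open Finset Filter Topology

/-- The score of a path `p` given emission logits `l` and transition matrix `A`:
the sum of emission scores plus the sum of transition scores over consecutive pairs. -/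
def score {n d : ℕ} (l : Fin (n + 1) → Fin d → ℝ) (A : Fin d → Fin d → ℝ)
    (p : Fin (n + 1) → Fin d) : ℝ :=
  (∑ i, l i (p i)) + ∑ i : Fin n, A (p i.castSucc) (p i.succ)

/-- The masked transition matrix: entries in the illegal set `Ω` are replaced by `c`. -/
def masked {d : ℕ} (Ω : Finset (Fin d × Fin d)) (A : Fin d → Fin d → ℝ) (c : ℝ) :
    Fin d → Fin d → ℝ :=
  fun i j => if (i, j) ∈ Ω then c else A i j

/-- A path is legal if it contains no illegal transition. -/
def Legal {n d : ℕ} (Ω : Finset (Fin d × Fin d)) (p : Fin (n + 1) → Fin d) : Prop :=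
  ∀ i : Fin n, (p i.castSucc, p i.succ) ∉ Ω

instance {n d : ℕ} (Ω : Finset (Fin d × Fin d)) : DecidablePred (Legal (n := n) Ω) :=
  fun _ => by unfold Legal; infer_instance

/-- Partition function: sum of exponentiated scores over all paths. -/
noncomputable def partAll {n d : ℕ} (l : Fin (n + 1) → Fin d → ℝ)
    (A : Fin d → Fin d → ℝ) : ℝ :=
  ∑ p : Fin (n + 1) → Fin d, Real.exp (score l A p)

/-- Restricted partition function: sum of exponentiated scores over legal paths. -/
noncomputable def partLegal {n d : ℕ} (Ω : Finset (Fin d × Fin d))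
    (l : Fin (n + 1) → Fin d → ℝ) (A : Fin d → Fin d → ℝ) : ℝ :=
  ∑ p ∈ Finset.univ.filter (Legal Ω), Real.exp (score l A p)

/-- The CRF likelihood of a ground-truth path `y`. -/
noncomputable def Lik {n d : ℕ} (y : Fin (n + 1) → Fin d) (l : Fin (n + 1) → Fin d → ℝ)
    (A : Fin d → Fin d → ℝ) : ℝ :=
  Real.exp (score l A y) / partAll l A

/-- The masked-CRF likelihood of a ground-truth path `y`. -/
noncomputable def LikM {n d : ℕ} (Ω : Finset (Fin d × Fin d)) (y : Fin (n + 1) → Fin d)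
    (l : Fin (n + 1) → Fin d → ℝ) (A : Fin d → Fin d → ℝ) : ℝ :=
  Real.exp (score l A y) / partLegal Ω l A

/-- The CRF loss over a family of `N` training samples. -/
noncomputable def crfLoss {n d : ℕ} (N : ℕ) (l : Fin N → Fin (n + 1) → Fin d → ℝ)
    (y : Fin N → Fin (n + 1) → Fin d) (A : Fin d → Fin d → ℝ) : ℝ :=
  -(1 / (N : ℝ)) * ∑ k, Real.log (Lik (y k) (l k) A)

/-- The masked-CRF loss over a family of `N` training samples. -/
noncomputable def mcrfLoss {n d : ℕ} (Ω : Finset (Fin d × Fin d)) (N : ℕ)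
    (l : Fin N → Fin (n + 1) → Fin d → ℝ) (y : Fin N → Fin (n + 1) → Fin d)
    (A : Fin d → Fin d → ℝ) : ℝ :=
  -(1 / (N : ℝ)) * ∑ k, Real.log (LikM Ω (y k) (l k) A)

/-- The number of transitions of a path `p` that lie in `S`. -/
def transitionCount {n d : ℕ} (S : Finset (Fin d × Fin d)) (p : Fin (n + 1) → Fin d) : ℕ :=
  #{k : Fin n | (p k.castSucc, p k.succ) ∈ S}

theorem transitionCount_eq_zero_iff {n d : ℕ} {S : Finset (Fin d × Fin d)}
    {p : Fin (n + 1) → Fin d} : transitionCount S p = 0 ↔ Legal S p := by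
  simp [transitionCount, Legal, Finset.filter_eq_empty_iff]

theorem Legal.anti {n d : ℕ} {S Ω : Finset (Fin d × Fin d)} (hS : S ⊆ Ω)
    {p : Fin (n + 1) → Fin d} (hp : Legal Ω p) : Legal S p :=
  fun k hk => hp k (hS hk)

theorem masked_masked_of_subset {d : ℕ} {S Ω : Finset (Fin d × Fin d)} (hS : S ⊆ Ω)
    (A : Fin d → Fin d → ℝ) (c : ℝ) : masked S (masked Ω A c) c = masked Ω A c := by
  ext a b
  by_cases h : (a, b) ∈ S
  · simp [masked, h, hS h]
  · simp [masked, h]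

theorem score_masked {n d : ℕ} (S : Finset (Fin d × Fin d)) (l : Fin (n + 1) → Fin d → ℝ)
    (A : Fin d → Fin d → ℝ) (c : ℝ) (p : Fin (n + 1) → Fin d) :
    score l (masked S A c) p = score l (masked S A 0) p + transitionCount S p * c := by
  have h : ∑ k : Fin n, masked S A c (p k.castSucc) (p k.succ) =
      ∑ k : Fin n, masked S A 0 (p k.castSucc) (p k.succ) + transitionCount S p * c := by
    rw [transitionCount, ← nsmul_eq_mul, ← Finset.sum_const, Finset.sum_filter,
      ← Finset.sum_add_distrib]
    refine Finset.sum_congr rfl fun k _ => ?_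
    by_cases hk : (p k.castSucc, p k.succ) ∈ S <;> simp [masked, hk]
  rw [score, score, h, add_assoc]

theorem score_masked_of_legal {n d : ℕ} {S : Finset (Fin d × Fin d)}
    {p : Fin (n + 1) → Fin d} (hp : Legal S p) (l : Fin (n + 1) → Fin d → ℝ)
    (A : Fin d → Fin d → ℝ) (c : ℝ) : score l (masked S A c) p = score l A p := by
  rw [score, score]
  exact congrArg _ (Finset.sum_congr rfl fun k _ => if_neg (hp k))

theorem hasDerivAt_exp_score_masked {n d : ℕ} (S : Finset (Fin d × Fin d))
    (l : Fin (n + 1) → Fin d → ℝ) (A : Fin d → Fin d → ℝ) (p : Fin (n + 1) → Fin d) (t : ℝ) :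
    HasDerivAt (fun t => Real.exp (score l (masked S A t) p))
      (Real.exp (score l (masked S A t) p) * transitionCount S p) t := by
  simpa [← score_masked] using (((hasDerivAt_id t).const_mul (transitionCount S p : ℝ)).const_add
    (score l (masked S A 0) p)).exp

theorem partAll_pos {n d : ℕ} (y : Fin (n + 1) → Fin d) (l : Fin (n + 1) → Fin d → ℝ)
    (A : Fin d → Fin d → ℝ) : 0 < partAll l A :=
  Finset.sum_pos (fun _ _ => Real.exp_pos _) ⟨y, Finset.mem_univ y⟩

theorem partLegal_pos {n d : ℕ} {Ω : Finset (Fin d × Fin d)} {y : Fin (n + 1) → Fin d}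
    (hy : Legal Ω y) (l : Fin (n + 1) → Fin d → ℝ) (A : Fin d → Fin d → ℝ) :
    0 < partLegal Ω l A :=
  Finset.sum_pos (fun _ _ => Real.exp_pos _) ⟨y, by simpa using hy⟩

/-- The CRF likelihood of a path avoiding `S` depends on the common value of the entries in `S`
only through the partition function. -/
theorem hasDerivAt_Lik_masked {n d : ℕ} {S : Finset (Fin d × Fin d)} {y : Fin (n + 1) → Fin d}
    (hy : Legal S y) (l : Fin (n + 1) → Fin d → ℝ) (A : Fin d → Fin d → ℝ) (t : ℝ) :
    HasDerivAt (fun t => Lik y l (masked S A t))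
      (-(Real.exp (score l A y) *
        ∑ p, Real.exp (score l (masked S A t) p) * transitionCount S p) /
          partAll l (masked S A t) ^ 2) t := by
  simp_rw [Lik, score_masked_of_legal hy]
  have hZ : HasDerivAt (fun t => partAll l (masked S A t))
      (∑ p, Real.exp (score l (masked S A t) p) * transitionCount S p) t :=
    HasDerivAt.fun_sum fun p _ => hasDerivAt_exp_score_masked S l A p t
  simpa using (hasDerivAt_const t (Real.exp (score l A y))).fun_div hZ
    (partAll_pos y l _).ne'

theorem tendsto_exp_score_masked {n d : ℕ} (Ω : Finset (Fin d × Fin d))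
    (l : Fin (n + 1) → Fin d → ℝ) (A : Fin d → Fin d → ℝ) (p : Fin (n + 1) → Fin d) :
    Tendsto (fun c => Real.exp (score l (masked Ω A c) p)) atBot
      (𝓝 (if Legal Ω p then Real.exp (score l A p) else 0)) := by
  split_ifs with hp
  · simp_rw [score_masked_of_legal hp]
    exact tendsto_const_nhds
  · have hpos : (0 : ℝ) < transitionCount Ω p :=
      Nat.cast_pos.2 (Nat.pos_of_ne_zero (mt transitionCount_eq_zero_iff.1 hp))
    refine Real.tendsto_exp_atBot.comp ((tendsto_atBot_add_const_left _ _
      (tendsto_id.const_mul_atBot hpos)).congr fun c => (score_masked Ω l A c p).symm)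

theorem tendsto_partAll_masked {n d : ℕ} (Ω : Finset (Fin d × Fin d))
    (l : Fin (n + 1) → Fin d → ℝ) (A : Fin d → Fin d → ℝ) :
    Tendsto (fun c => partAll l (masked Ω A c)) atBot (𝓝 (partLegal Ω l A)) := by
  rw [partLegal, Finset.sum_filter]
  exact tendsto_finsetSum _ fun p _ => tendsto_exp_score_masked Ω l A p

theorem tendsto_sum_exp_score_masked_mul_transitionCount {n d : ℕ}
    {S Ω : Finset (Fin d × Fin d)} (hS : S ⊆ Ω) (l : Fin (n + 1) → Fin d → ℝ)
    (A : Fin d → Fin d → ℝ) :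
    Tendsto (fun c => ∑ p, Real.exp (score l (masked Ω A c) p) * transitionCount S p) atBot
      (𝓝 0) := by
  rw [← Finset.sum_const_zero (s := (Finset.univ : Finset (Fin (n + 1) → Fin d)))]
  refine tendsto_finsetSum _ fun p _ => ?_
  have h := (tendsto_exp_score_masked Ω l A p).mul_const (transitionCount S p : ℝ)
  by_cases hp : Legal Ω p
  · simp [transitionCount_eq_zero_iff.2 (hp.anti hS)]
  · simpa [hp] using h

/-- Lemma 1, (14): the derivative of the CRF likelihood with respect to a
masked entry `(i, j) ∈ Ω`, evaluated at the mask value `c`, tends to `0` as `c → -∞`. -/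
theorem stmt_6 {n d : ℕ} (hd : 1 ≤ d) (Ω : Finset (Fin d × Fin d))
    (i j : Fin d) (hij : (i, j) ∈ Ω)
    (y : Fin (n + 1) → Fin d) (hy : Legal Ω y)
    (l : Fin (n + 1) → Fin d → ℝ) (A₀ : Fin d → Fin d → ℝ) :
    Tendsto (fun c : ℝ =>
        deriv (fun t : ℝ =>
          Lik y l (fun i' j' => if (i', j') = (i, j) then t else masked Ω A₀ c i' j')) c)
      atBot (𝓝 0) := by
  have hS : {(i, j)} ⊆ Ω := Finset.singleton_subset_iff.2 hij
  have hB : ∀ c t : ℝ, (fun i' j' => if (i', j') = (i, j) then t else masked Ω A₀ c i' j') =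
      masked {(i, j)} (masked Ω A₀ c) t := fun c t => by
    ext a b
    simp only [masked, Finset.mem_singleton]
  simp_rw [hB, (hasDerivAt_Lik_masked (hy.anti hS) l _ _).deriv, masked_masked_of_subset hS,
    score_masked_of_legal hy]
  simpa [Pi.div_def] using ((tendsto_sum_exp_score_masked_mul_transitionCount hS l A₀).const_mul
    (Real.exp (score l A₀ y))).neg.div ((tendsto_partAll_masked Ω l A₀).pow 2)
    (pow_pos (partLegal_pos hy l A₀) 2).ne'
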